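/- arXiv:2501.15126 — 4 statements merged into one kernel-verified Lean document; each statement's English description precedes it below -/
import Mathlib

section
/- (Absence of control divergence for power-of-two chunks, main case.) Let k ≥ 1 and let ℓ be an integer with 1 ≤ ℓ < 2^k and ℓ ≠ 2^{k−1}. Then for every natural number t, writing i_t = ℓ + t·2^k and j = v₂(ℓ): (a) v₂(i_t) = j, and (b) the quotients (i_t − 2^j)/2^{j+1} and (ℓ − 2^j)/2^{j+1} have the same parity. Hence all threads t process the same column j with the same inclusion/exclusion direction at local iteration ℓ. -/
theorem padicValNat_two_pow_mul_odd (j q : ℕ) :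
    padicValNat 2 (2 ^ j * (2 * q + 1)) = j := by
  rw [padicValNat.mul (by positivity) (by omega), padicValNat.prime_pow,
    padicValNat.eq_zero_of_not_dvd (by omega), add_zero]

theorem two_pow_mul_odd_sub_div (j q : ℕ) :
    (2 ^ j * (2 * q + 1) - 2 ^ j) / 2 ^ (j + 1) = q := by
  have h : 2 ^ j * (2 * q + 1) - 2 ^ j = 2 ^ (j + 1) * q := by
    rw [mul_add, mul_one, Nat.add_sub_cancel, pow_succ, mul_assoc]
  rw [h, Nat.mul_div_cancel_left _ (by positivity)]


/-- Absence of control divergence for power-of-two chunks, main case: for `k ≥ 1`,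
`1 ≤ ℓ < 2^k` with `ℓ ≠ 2^(k-1)`, every thread `t` (executing global iteration
`i_t = ℓ + t·2^k`) has the same changed-bit index `j = v₂(ℓ)` and the same
inclusion/exclusion direction as local iteration `ℓ`. -/
theorem no_control_divergence_main_case (k ℓ : ℕ) (hk : 1 ≤ k)
    (hℓ1 : 1 ≤ ℓ) (hℓ2 : ℓ < 2 ^ k) (hℓ3 : ℓ ≠ 2 ^ (k - 1)) (t : ℕ) :
    padicValNat 2 (ℓ + t * 2 ^ k) = padicValNat 2 ℓ ∧
    (Even ((ℓ + t * 2 ^ k - 2 ^ (padicValNat 2 ℓ)) / 2 ^ (padicValNat 2 ℓ + 1)) ↔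
      Even ((ℓ - 2 ^ (padicValNat 2 ℓ)) / 2 ^ (padicValNat 2 ℓ + 1))) := by
  obtain ⟨j, m, hm, rfl⟩ := Nat.exists_eq_two_pow_mul_odd (n := ℓ) (by omega)
  obtain ⟨q, rfl⟩ := hm
  have hjk : j < k := by
    rw [← Nat.pow_lt_pow_iff_right (a := 2) (by norm_num)]
    exact (Nat.le_mul_of_pos_right _ (by omega)).trans_lt hℓ2
  have hne : k ≠ j + 1 := by
    rintro rfl
    rw [pow_succ, Nat.mul_lt_mul_left (by positivity)] at hℓ2
    obtain rfl : q = 0 := by omega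
    simp at hℓ3
  obtain ⟨c, rfl⟩ : ∃ c, k = j + 2 + c := Nat.exists_eq_add_of_le (by omega)
  have hi : 2 ^ j * (2 * q + 1) + t * 2 ^ (j + 2 + c) =
      2 ^ j * (2 * (q + 2 * (t * 2 ^ c)) + 1) := by ring
  rw [hi, padicValNat_two_pow_mul_odd, padicValNat_two_pow_mul_odd,
    two_pow_mul_odd_sub_div, two_pow_mul_odd_sub_div]
  exact ⟨rfl, by simp [Nat.even_add]⟩
end

section
/- (Sign alternation under reflection of the changed-bit sequence.) Let k ≥ 1 and let i be an integer with 1 ≤ i < 2^{k−1}. Set j = v₂(i) (so j ≤ k − 2, and also v₂(2^k − i) = j). Then the quotients (i − 2^j)/2^{j+1} and ((2^k − i) − 2^j)/2^{j+1} have opposite parities. Hence in the signed changed-bit sequence of a k-bit Gray code, the entry at index 2^k − i processes the same column as the entry at index i but with the opposite inclusion/exclusion sign, realizing the identity Scbs(k) = [Scbs(k−1), +(k−1), −Scbs(k−1)^R]. -/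
theorem two_pow_sub_two_pow_mul_odd {m q : ℕ} (j : ℕ) (hq : q < 2 ^ (m + 1)) :
    2 ^ (j + 2 + m) - 2 ^ j * (2 * q + 1) = 2 ^ j * (2 * (2 ^ (m + 1) - q - 1) + 1) := by
  obtain ⟨r, hr⟩ := Nat.exists_eq_add_of_lt hq
  have h : 2 ^ (j + 2 + m) = 2 ^ j * (2 * r + 1) + 2 ^ j * (2 * q + 1) := by
    rw [show j + 2 + m = j + 1 + (m + 1) by ring, pow_add, hr]
    ring
  rw [h, Nat.add_sub_cancel, hr, show q + r + 1 - q - 1 = r by lia]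

/-- Sign alternation under reflection of the changed-bit sequence: for `k ≥ 1` and
`1 ≤ i < 2^(k-1)`, with `j = v₂(i)` one has `j ≤ k - 2`, `v₂(2^k - i) = j`, and the
quotients `(i - 2^j)/2^(j+1)` and `((2^k - i) - 2^j)/2^(j+1)` have opposite parities:
the entry at index `2^k - i` processes the same column as the entry at index `i`
but with the opposite inclusion/exclusion sign. -/
theorem sign_alternation_reflection (k i : ℕ) (hk : 1 ≤ k)
    (hi1 : 1 ≤ i) (hi2 : i < 2 ^ (k - 1)) :
    padicValNat 2 i ≤ k - 2 ∧
    padicValNat 2 (2 ^ k - i) = padicValNat 2 i ∧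
    (Even ((i - 2 ^ (padicValNat 2 i)) / 2 ^ (padicValNat 2 i + 1)) ↔
      Odd ((2 ^ k - i - 2 ^ (padicValNat 2 i)) / 2 ^ (padicValNat 2 i + 1))) := by
  obtain ⟨j, n, ⟨q, rfl⟩, rfl⟩ := Nat.exists_eq_two_pow_mul_odd (n := i) (by lia)
  have hj : j < k - 1 := by
    rw [← Nat.pow_lt_pow_iff_right (a := 2) (by lia)]
    exact (Nat.le_mul_of_pos_right _ (by lia)).trans_lt hi2
  obtain ⟨m, rfl⟩ : ∃ m, k = j + 2 + m := ⟨k - (j + 2), by lia⟩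
  have hq : q < 2 ^ (m + 1) := by
    rw [show j + 2 + m - 1 = j + (m + 1) by lia, pow_add,
      Nat.mul_lt_mul_left (by positivity)] at hi2
    lia
  rw [two_pow_sub_two_pow_mul_odd j hq]
  simp only [padicValNat_two_pow_mul_odd, two_pow_mul_odd_sub_div]
  refine ⟨by lia, trivial, ?_⟩
  rw [pow_succ] at hq ⊢
  grind
end

section
/- (Ryser's formula.) For every n × n matrix A = [a_{ij}] over a commutative ring, perm(A) = (−1)^n · Σ_{S ⊆ {1,…,n}} (−1)^{|S|} · Π_{i=1}^{n} ( Σ_{j ∈ S} a_{ij} ), where the outer sum runs over all subsets S of the column indices {1, …, n}. -/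
/-- The permanent of an `n × n` matrix over a commutative ring. -/
def permanent {n : ℕ} {R : Type*} [CommRing R] (A : Matrix (Fin n) (Fin n) R) : R :=
  ∑ σ : Equiv.Perm (Fin n), ∏ i, A i (σ i)

/-- The signed sum over the sets containing the range of `f` detects surjectivity of `f`. -/
theorem sum_powerset_neg_one_pow_card_ite_forall_mem {ι κ R : Type*} [Fintype κ] [DecidableEq κ]
    [CommRing R] (f : ι → κ) [∀ S : Finset κ, Decidable (∀ i, f i ∈ S)]
    [Decidable (Function.Surjective f)] :
    ∑ S ∈ (Finset.univ : Finset κ).powerset, (-1 : R) ^ S.card * (if ∀ i, f i ∈ S then 1 else 0) =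
      if Function.Surjective f then (-1) ^ Fintype.card κ else 0 := by
  classical
  have h := Finset.prod_add (fun _ : κ => (-1 : R))
    (fun j => if ∃ i, f i = j then 0 else 1) Finset.univ
  trans ∏ j : κ, ((-1 : R) + if ∃ i, f i = j then 0 else 1)
  · rw [h]
    refine Finset.sum_congr rfl fun S _ => ?_
    rw [Finset.prod_const]
    congr 1
    split_ifs with hS
    · refine (Finset.prod_eq_one fun j hj => if_neg ?_).symm
      rintro ⟨i, rfl⟩
      exact (Finset.mem_sdiff.mp hj).2 (hS i)
    · push Not at hS
      obtain ⟨i, hi⟩ := hS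
      symm
      exact Finset.prod_eq_zero (Finset.mem_sdiff.mpr ⟨Finset.mem_univ (f i), hi⟩)
        (if_pos ⟨i, rfl⟩)
  · split_ifs with hf
    · have hf' : ∀ j, ∃ i, f i = j := hf
      simp [hf']
    · rw [Function.Surjective] at hf
      push Not at hf
      obtain ⟨j, hj⟩ := hf
      exact Finset.prod_eq_zero (Finset.mem_univ j) (by simp [hj])

/-- A product of sums over `S` expands as a sum over all functions with values in `S`. -/
theorem prod_sum_eq_sum_ite_forall_mem {ι κ R : Type*} [Fintype ι] [DecidableEq ι] [Fintype κ]
    [DecidableEq κ] [CommRing R] (S : Finset κ) (a : ι → κ → R) :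
    ∏ i, ∑ j ∈ S, a i j =
      ∑ f : ι → κ, (if ∀ i, f i ∈ S then 1 else 0) * ∏ i, a i (f i) := by
  rw [Finset.prod_univ_sum]
  simp only [ite_mul, one_mul, zero_mul, ← Finset.sum_filter]
  refine Finset.sum_congr ?_ fun _ _ => rfl
  ext f
  simp

/-- Over a finite type, summing over permutations is summing over surjective self-maps. -/
theorem sum_perm_eq_sum_ite_surjective {ι R : Type*} [Fintype ι] [DecidableEq ι]
    [CommRing R] [∀ f : ι → ι, Decidable (Function.Surjective f)] (g : (ι → ι) → R) :
    ∑ σ : Equiv.Perm ι, g σ = ∑ f : ι → ι, if Function.Surjective f then g f else 0 := by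
  rw [← Finset.sum_filter]
  refine Finset.sum_bij (fun σ _ => ⇑σ) (fun σ _ => by simpa using σ.surjective)
    (fun σ _ τ _ h => DFunLike.coe_injective h) (fun f hf => ?_) fun _ _ => rfl
  have hf' : Function.Surjective f := by simpa using hf
  exact ⟨Equiv.ofBijective f (Finite.surjective_iff_bijective.mp hf'), Finset.mem_univ _, rfl⟩

/-- Ryser's formula for a function of two variables in a finite type. -/
theorem sum_perm_prod_eq_alternating_sum {ι R : Type*} [Fintype ι] [DecidableEq ι]
    [CommRing R] (a : ι → ι → R) :
    ∑ σ : Equiv.Perm ι, ∏ i, a i (σ i) =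
      (-1) ^ Fintype.card ι * ∑ S ∈ (Finset.univ : Finset ι).powerset,
        (-1) ^ S.card * ∏ i, ∑ j ∈ S, a i j := by
  classical
  simp only [prod_sum_eq_sum_ite_forall_mem, Finset.mul_sum (Finset.univ : Finset (ι → ι))]
  rw [Finset.sum_comm, sum_perm_eq_sum_ite_surjective fun f => ∏ i, a i (f i), Finset.mul_sum]
  refine Finset.sum_congr rfl fun f _ => ?_
  simp only [← mul_assoc, ← Finset.sum_mul]
  rw [sum_powerset_neg_one_pow_card_ite_forall_mem]
  split_ifs
  · rw [← mul_pow]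
    simp
  · simp

/-- Ryser's formula: `perm(A) = (-1)^n · Σ_{S ⊆ {1,…,n}} (-1)^{|S|} · Π_i (Σ_{j ∈ S} a_{ij})`,
where the outer sum runs over all subsets of the column indices. -/
theorem ryser_formula {n : ℕ} {R : Type*} [CommRing R] (A : Matrix (Fin n) (Fin n) R) :
    permanent A =
      (-1) ^ n * ∑ S ∈ (Finset.univ : Finset (Fin n)).powerset,
        (-1) ^ S.card * ∏ i, ∑ j ∈ S, A i j := by
  simpa only [permanent, Fintype.card_fin] using sum_perm_prod_eq_alternating_sum A
end

section
/- (Nijenhuis–Wilf variant of Ryser's formula.) Let n ≥ 1 and let A = [a_{ij}] be an n × n matrix over ℝ (or any commutative ring in which 2 is invertible). For each row i define x_i = a_{i,n} − (1/2)·Σ_{j=1}^{n} a_{ij}. Then perm(A) = 2·(−1)^{n−1} · Σ_{S ⊆ {1,…,n−1}} (−1)^{|S|} · Π_{i=1}^{n} ( x_i + Σ_{j ∈ S} a_{ij} ), where the sum runs over all subsets S of the first n − 1 column indices. In particular the outer sum has only 2^{n−1} terms, and the prefactor 2·(−1)^{n−1} equals 4·(n mod 2) − 2. -/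
open Finset in
/-- The signed count of the sets containing a fixed set `U` vanishes unless `U` is everything. -/
theorem sum_neg_one_pow_card_of_subset {ι R : Type*} [Fintype ι] [DecidableEq ι] [CommRing R]
    (U : Finset ι) :
    ∑ T : Finset ι, (-1 : R) ^ #T * (if U ⊆ T then 1 else 0) =
      if U = univ then (-1) ^ Fintype.card ι else 0 := by
  have h := prod_add (fun _ : ι => (-1 : R)) (fun j => if j ∉ U then 1 else 0) univ
  rw [powerset_univ] at h
  have h₁ : ∀ T : Finset ι, (∀ j ∈ univ \ T, j ∉ U) ↔ U ⊆ T := fun T => by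
    simp only [mem_sdiff, mem_univ, true_and, subset_iff]
    exact forall_congr' fun j => by tauto
  simp only [prod_const, prod_ite_zero, one_pow, h₁] at h
  rw [← h]
  split_ifs with hU
  · simp [hU]
  · obtain ⟨j, hj⟩ : ∃ j, j ∉ U := by simpa [eq_univ_iff_forall] using hU
    exact prod_eq_zero (mem_univ j) (by simp [hj])

open Finset in
/-- **Ryser's formula**, with an arbitrary shift `c i` added to the `i`-th row sums. -/
theorem sum_neg_one_pow_card_mul_prod_add_sum {ι R : Type*} [Fintype ι] [DecidableEq ι]
    [CommRing R] (A : Matrix ι ι R) (c : ι → R) :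
    ∑ T : Finset ι, (-1) ^ #T * ∏ i, (c i + ∑ j ∈ T, A i j) =
      (-1) ^ Fintype.card ι * ∑ σ : Equiv.Perm ι, ∏ i, A i (σ i) := by
  let b : ι → Option ι → R := fun i o => o.elim (c i) (A i)
  let range : (ι → Option ι) → Finset ι := fun f => {j | ∃ i, f i = some j}
  have expand (T : Finset ι) : ∏ i, (c i + ∑ j ∈ T, A i j) =
      ∑ f : ι → Option ι, (if range f ⊆ T then 1 else 0) * ∏ i, b i (f i) := by
    have h₁ (i : ι) : c i + ∑ j ∈ T, A i j =
        ∑ o : Option ι, (if ∀ j, o = some j → j ∈ T then 1 else 0) * b i o := by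
      simp [Fintype.sum_option, b]
    have h₂ (f : ι → Option ι) : (∀ i ∈ univ, ∀ j, f i = some j → j ∈ T) ↔ range f ⊆ T := by
      simp only [range, subset_iff, mem_filter, mem_univ, true_and, forall_true_left]
      exact ⟨fun h j ⟨i, hi⟩ => h i j hi, fun h i j hi => h ⟨i, hi⟩⟩
    simp only [h₁]
    rw [prod_univ_sum, Fintype.piFinset_univ]
    refine sum_congr rfl fun f _ => ?_
    rw [prod_mul_distrib, prod_ite_zero, prod_const_one]
    simp only [h₂]
  simp only [expand, mul_sum]
  rw [sum_comm]
  simp only [← mul_assoc, ← sum_mul, sum_neg_one_pow_card_of_subset]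
  simp only [ite_mul, zero_mul]
  rw [← sum_filter]
  symm
  refine sum_bij (fun σ _ i => some (σ i)) ?_ ?_ ?_ ?_
  · intro σ _
    simp only [range, mem_filter, mem_univ, true_and, eq_univ_iff_forall, Option.some_inj]
    exact σ.surjective
  · intro σ _ τ _ h
    ext i
    exact Option.some_inj.mp (congrFun h i)
  · intro f hf
    simp only [range, mem_filter, mem_univ, true_and, eq_univ_iff_forall] at hf
    choose g hg using hf
    have inj : Function.Injective g := fun j k h =>
      Option.some_inj.mp ((hg j).symm.trans (h ▸ hg k))
    let e := Equiv.ofBijective g (Finite.injective_iff_bijective.mp inj)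
    refine ⟨e.symm, mem_univ _, funext fun i => ?_⟩
    rw [← hg (e.symm i)]
    exact congrArg f (e.apply_symm_apply i)
  · intro σ _
    rfl

/-- Nijenhuis–Wilf variant of Ryser's formula for an `(n+1) × (n+1)` real matrix
(so the dimension is at least 1): with `x i = a_{i,last} - (1/2)·Σ_j a_{ij}`,
`perm(A) = 2·(-1)^n · Σ_{S ⊆ columns \ {last}} (-1)^{|S|} · Π_i (x i + Σ_{j ∈ S} a_{ij})`.
The outer sum has only `2^n` terms, and the prefactor `2·(-1)^n` (for dimension `n+1`)
equals `4·((n+1) mod 2) - 2`. -/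
theorem nijenhuis_wilf_formula {n : ℕ} (A : Matrix (Fin (n + 1)) (Fin (n + 1)) ℝ)
    (x : Fin (n + 1) → ℝ)
    (hx : ∀ i, x i = A i (Fin.last n) - (1 / 2) * ∑ j, A i j) :
    (permanent A =
      2 * (-1) ^ n *
        ∑ S ∈ ((Finset.univ : Finset (Fin (n + 1))).erase (Fin.last n)).powerset,
          (-1) ^ S.card * ∏ i, (x i + ∑ j ∈ S, A i j)) ∧
    (((Finset.univ : Finset (Fin (n + 1))).erase (Fin.last n)).powerset.card = 2 ^ n) ∧
    (2 * (-1 : ℝ) ^ n = 4 * (((n + 1) % 2 : ℕ) : ℝ) - 2) := by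
  have sums : 2 * ∑ S ∈ ((Finset.univ : Finset (Fin (n + 1))).erase (Fin.last n)).powerset,
      (-1) ^ S.card * ∏ i, (x i + ∑ j ∈ S, A i j) = (-1) ^ n * permanent A := by
    have ryser := sum_neg_one_pow_card_mul_prod_add_sum A (fun i => -(1 / 2) * ∑ j, A i j)
    set E := (Finset.univ : Finset (Fin (n + 1))).erase (Fin.last n) with hE
    have hlast : Fin.last n ∉ E := by simp [hE]
    have hins : insert (Fin.last n) E = Finset.univ := by simp [hE]
    have hcard : E.card = n := by simp [hE]
    rw [← Finset.powerset_univ, ← hins, Finset.sum_powerset_insert hlast] at ryser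
    have with_last : ∑ S ∈ E.powerset, (-1 : ℝ) ^ (insert (Fin.last n) S).card *
          ∏ i, (-(1 / 2) * ∑ j, A i j + ∑ j ∈ insert (Fin.last n) S, A i j) =
        -∑ S ∈ E.powerset, (-1) ^ S.card * ∏ i, (x i + ∑ j ∈ S, A i j) := by
      rw [← Finset.sum_neg_distrib]
      refine Finset.sum_congr rfl fun S hS => ?_
      have hS' : Fin.last n ∉ S := fun h => hlast (Finset.mem_powerset.mp hS h)
      rw [Finset.card_insert_of_notMem hS', pow_succ, mul_neg_one, neg_mul]
      congr 2
      refine Finset.prod_congr rfl fun i _ => ?_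
      rw [Finset.sum_insert hS', hx]
      ring
    have without_last : ∑ S ∈ E.powerset, (-1 : ℝ) ^ S.card *
          ∏ i, (-(1 / 2) * ∑ j, A i j + ∑ j ∈ S, A i j) =
        -∑ S ∈ E.powerset, (-1) ^ S.card * ∏ i, (x i + ∑ j ∈ S, A i j) := by
      rw [← Finset.sum_neg_distrib]
      refine Finset.sum_bij' (fun S _ => E \ S) (fun S _ => E \ S) (by simp) (by simp)
        (fun S hS => by simpa using hS) (fun S hS => by simpa using hS) fun S hS => ?_
      have hSE := Finset.mem_powerset.mp hS
      have row (i : Fin (n + 1)) : -(1 / 2) * ∑ j, A i j + ∑ j ∈ S, A i j =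
          -(x i + ∑ j ∈ E \ S, A i j) := by
        have total : ∑ j, A i j = A i (Fin.last n) + ∑ j ∈ E, A i j := by
          rw [← hins, Finset.sum_insert hlast]
        have split := Finset.sum_sdiff (f := A i) hSE
        rw [hx]
        linarith
      have sign : (-1 : ℝ) ^ S.card * (-1) ^ (n + 1) = -(-1) ^ (E \ S).card := by
        have h := Finset.card_sdiff_add_card_eq_card hSE
        rw [show (-1 : ℝ) ^ (n + 1) = (-1) ^ ((E \ S).card + S.card + 1) by rw [h, hcard],
          pow_succ, pow_add]
        have := pow_mul_pow_eq_one S.card (show (-1 : ℝ) * -1 = 1 by norm_num)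
        linear_combination -(-1 : ℝ) ^ (E \ S).card * this
      simp only [row, Finset.prod_neg, Finset.card_univ, Fintype.card_fin]
      rw [← mul_assoc, sign, neg_mul]
    rw [hins] at ryser
    rw [with_last, without_last, Fintype.card_fin, pow_succ] at ryser
    change _ = _ * permanent A at ryser
    linarith
  refine ⟨?_, by simp, ?_⟩
  · rw [mul_right_comm, sums, mul_right_comm, pow_mul_pow_eq_one n (by norm_num), one_mul]
  · rcases Nat.even_or_odd n with h | h
    · rw [h.neg_one_pow, Nat.odd_iff.mp h.add_one]
      norm_num
    · rw [h.neg_one_pow, Nat.even_iff.mp h.add_one]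
      norm_num
end
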